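/- Let u, v, w, z : ℝ × ℝ → ℝ be smooth functions of (x,t) solving the generalized Riemann equation at N=4, i.e. u_t = 2u·u_x − 2v, v_t = 2u·v_x − 2w, w_t = 2u·w_x − 2z, z_t = 2u·z_x, with z_x nowhere zero. Fix n ≥ 2, let Q : ℝ^{4(n−1)} → ℝ be a smooth function of (a₁, b₁, c₁, d₁, …, a_{n−1}, b_{n−1}, c_{n−1}, d_{n−1}), and let P : ℝ^{4n} → ℝ be a smooth function of (a₁, b₁, c₁, d₁, …, a_n, b_n, c_n, d_n) whose partial derivative with respect to d₁ satisfies ∂P/∂d₁ = −(1/2)·Σ_{k=1}^{n−1}[(∂Q/∂a_k)·a_{k+1} + (∂Q/∂b_k)·b_{k+1} + (∂Q/∂c_k)·c_{k+1} + (∂Q/∂d_k)·d_{k+1}] identically on ℝ^{4n}. Then the function H = z_x·P(α₁, β₁, γ₁, δ₁, …, α_n, β_n, γ_n, δ_n) satisfies ∂_t H = ∂_x(2u·H + Q(α₁, β₁, γ₁, δ₁, …, α_{n−1}, β_{n−1}, γ_{n−1}, δ_{n−1})) at every point. -/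

import Mathlib

/-- Partial derivative with respect to the first variable `x`. -/
noncomputable def pdx (f : ℝ × ℝ → ℝ) (p : ℝ × ℝ) : ℝ := deriv (fun x => f (x, p.2)) p.1

/-- Partial derivative with respect to the second variable `t`. -/
noncomputable def pdt (f : ℝ × ℝ → ℝ) (p : ℝ × ℝ) : ℝ := deriv (fun t => f (p.1, t)) p.2

/-- Partial derivative of a function on `ℝ^m` with respect to the `i`-th coordinate. -/
noncomputable def pD {m : ℕ} (f : (Fin m → ℝ) → ℝ) (i : Fin m) (y : Fin m → ℝ) : ℝ :=
  deriv (fun s => f (Function.update y i s)) (y i)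

theorem hasDerivAt_line {f : ℝ × ℝ → ℝ} {p : ℝ × ℝ} (hf : DifferentiableAt ℝ f p) (a b : ℝ) :
    HasDerivAt (fun s : ℝ => f (p.1 + s * a, p.2 + s * b)) (fderiv ℝ f p (a, b)) 0 := by
  have hc : HasDerivAt (fun s : ℝ => (p.1 + s * a, p.2 + s * b)) (a, b) 0 := by
    have h1 := ((hasDerivAt_id (0 : ℝ)).mul_const a).const_add p.1
    have h2 := ((hasDerivAt_id (0 : ℝ)).mul_const b).const_add p.2
    simpa using h1.prodMk h2
  refine HasFDerivAt.comp_hasDerivAt (0 : ℝ) (l := f) ?_ hc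
  simpa using hf.hasFDerivAt

theorem pdx_eq_fderiv {f : ℝ × ℝ → ℝ} {p : ℝ × ℝ} (hf : DifferentiableAt ℝ f p) :
    pdx f p = fderiv ℝ f p (1, 0) := by
  have hc : HasDerivAt (fun x : ℝ => (x, p.2)) ((1 : ℝ), (0 : ℝ)) p.1 :=
    (hasDerivAt_id p.1).prodMk (hasDerivAt_const p.1 p.2)
  exact (HasFDerivAt.comp_hasDerivAt p.1 (l := f) hf.hasFDerivAt hc).deriv

theorem pdt_eq_fderiv {f : ℝ × ℝ → ℝ} {p : ℝ × ℝ} (hf : DifferentiableAt ℝ f p) :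
    pdt f p = fderiv ℝ f p (0, 1) := by
  have hc : HasDerivAt (fun t : ℝ => (p.1, t)) ((0 : ℝ), (1 : ℝ)) p.2 :=
    (hasDerivAt_const p.2 p.1).prodMk (hasDerivAt_id p.2)
  exact (HasFDerivAt.comp_hasDerivAt p.2 (l := f) hf.hasFDerivAt hc).deriv

theorem fderiv_apply_eq_pdx_pdt {f : ℝ × ℝ → ℝ} {p : ℝ × ℝ} (hf : DifferentiableAt ℝ f p)
    (a b : ℝ) : fderiv ℝ f p (a, b) = a * pdx f p + b * pdt f p := by
  have h : ((a, b) : ℝ × ℝ) = a • ((1 : ℝ), (0 : ℝ)) + b • ((0 : ℝ), (1 : ℝ)) := by simp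
  rw [pdx_eq_fderiv hf, pdt_eq_fderiv hf, h, map_add, map_smul, map_smul, smul_eq_mul, smul_eq_mul]

theorem ContDiff.differentiableAt_of_smooth {E : Type*} [NormedAddCommGroup E] [NormedSpace ℝ E]
    {f : E → ℝ} (hf : ContDiff ℝ (⊤ : ℕ∞) f) (p : E) : DifferentiableAt ℝ f p :=
  (hf.differentiable (by simp)) p

theorem ContDiff.pdx {f : ℝ × ℝ → ℝ} (hf : ContDiff ℝ (⊤ : ℕ∞) f) :
    ContDiff ℝ (⊤ : ℕ∞) (pdx f) := by
  have h : _root_.pdx f = fun p => fderiv ℝ f p (1, 0) :=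
    funext fun p => pdx_eq_fderiv (hf.differentiableAt_of_smooth p)
  rw [h]
  exact (hf.fderiv_right (m := (⊤ : ℕ∞)) (by simp)).clm_apply contDiff_const

/-- Mixed partial derivatives of a smooth function commute. -/
theorem pdt_pdx_comm {f : ℝ × ℝ → ℝ} (hf : ContDiff ℝ (⊤ : ℕ∞) f) (p : ℝ × ℝ) :
    pdt (pdx f) p = pdx (pdt f) p := by
  have hx : pdx f = fun p => fderiv ℝ f p (1, 0) :=
    funext fun p => pdx_eq_fderiv (hf.differentiableAt_of_smooth p)
  have ht : pdt f = fun p => fderiv ℝ f p (0, 1) :=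
    funext fun p => pdt_eq_fderiv (hf.differentiableAt_of_smooth p)
  have hd : DifferentiableAt ℝ (fderiv ℝ f) p :=
    ((hf.fderiv_right (m := (⊤ : ℕ∞)) (by simp)).differentiable (by simp)) p
  have hsymm : IsSymmSndFDerivAt ℝ f p :=
    hf.contDiffAt.isSymmSndFDerivAt (by
      simpa using (by exact_mod_cast le_top : ((2 : ℕ∞) : WithTop ℕ∞) ≤ ((⊤ : ℕ∞) : WithTop ℕ∞)))
  have key : ∀ e : ℝ × ℝ, HasFDerivAt (fun q => fderiv ℝ f q e)
      ((fderiv ℝ (fderiv ℝ f) p).flip e) p := fun e => by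
    simpa using hd.hasFDerivAt.clm_apply (hasFDerivAt_const e p)
  rw [hx, ht, pdt_eq_fderiv (key _).differentiableAt, pdx_eq_fderiv (key _).differentiableAt,
    (key _).fderiv, (key _).fderiv]
  exact hsymm _ _

/-- The derivative of `f` at `p` along the characteristic direction `(-2u, 1)`. -/
theorem hasDerivAt_characteristic {u f : ℝ × ℝ → ℝ} {p : ℝ × ℝ} (hf : DifferentiableAt ℝ f p)
    {g : ℝ} (h : pdt f p = 2 * u p * pdx f p + g) :
    HasDerivAt (fun s : ℝ => f (p.1 + s * (-2 * u p), p.2 + s * 1)) g 0 := by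
  convert hasDerivAt_line hf (-2 * u p) 1 using 1
  rw [fderiv_apply_eq_pdx_pdt hf, h]
  ring

theorem pdt_of_hasDerivAt_characteristic {u f : ℝ × ℝ → ℝ} {p : ℝ × ℝ}
    (hf : DifferentiableAt ℝ f p) {g : ℝ}
    (h : HasDerivAt (fun s : ℝ => f (p.1 + s * (-2 * u p), p.2 + s * 1)) g 0) :
    pdt f p = 2 * u p * pdx f p + g := by
  have h1 := h.unique (hasDerivAt_line hf (-2 * u p) 1)
  rw [fderiv_apply_eq_pdx_pdt hf] at h1
  linarith

theorem pdt_pdx_of_transport {u f g : ℝ × ℝ → ℝ} (hu : ContDiff ℝ (⊤ : ℕ∞) u)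
    (hf : ContDiff ℝ (⊤ : ℕ∞) f) (hg : ContDiff ℝ (⊤ : ℕ∞) g)
    (h : ∀ p, pdt f p = 2 * u p * pdx f p + g p) (p : ℝ × ℝ) :
    pdt (pdx f) p = 2 * u p * pdx (pdx f) p + (2 * pdx u p * pdx f p + pdx g p) := by
  have slice : ∀ {k : ℝ × ℝ → ℝ}, ContDiff ℝ (⊤ : ℕ∞) k →
      HasDerivAt (fun x => k (x, p.2)) (pdx k p) p.1 := fun {k} hk =>
    (((hk.differentiableAt_of_smooth (p.1, p.2)).comp p.1
      (differentiableAt_id.prodMk (differentiableAt_const p.2))).hasDerivAt)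
  rw [pdt_pdx_comm hf, funext h]
  refine HasDerivAt.deriv ?_
  refine ((((slice hu).const_mul 2).mul (slice hf.pdx)).add (slice hg)).congr_deriv ?_
  ring

theorem contDiff_tower {z : ℝ × ℝ → ℝ} (hz : ContDiff ℝ (⊤ : ℕ∞) z) (hzx : ∀ p, pdx z p ≠ 0)
    {f : ℕ → ℝ × ℝ → ℝ} (h1 : ContDiff ℝ (⊤ : ℕ∞) (f 1))
    (hrec : ∀ k, 1 ≤ k → ∀ p, f (k + 1) p = (pdx z p)⁻¹ * pdx (f k) p) (k : ℕ) :
    ContDiff ℝ (⊤ : ℕ∞) (f (k + 1)) := by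
  induction k with
  | zero => exact h1
  | succ k ih =>
    rw [funext (hrec (k + 1) (by omega))]
    exact (hz.pdx.inv hzx).mul ih.pdx

theorem transport_tower {u z : ℝ × ℝ → ℝ} (hu : ContDiff ℝ (⊤ : ℕ∞) u)
    (hz : ContDiff ℝ (⊤ : ℕ∞) z) (heqz : ∀ p, pdt z p = 2 * u p * pdx z p)
    (hzx : ∀ p, pdx z p ≠ 0) {f : ℕ → ℝ × ℝ → ℝ} (h1 : ContDiff ℝ (⊤ : ℕ∞) (f 1))
    (hrec : ∀ k, 1 ≤ k → ∀ p, f (k + 1) p = (pdx z p)⁻¹ * pdx (f k) p) {c : ℝ}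
    (ht : ∀ p, pdt (f 1) p = 2 * u p * pdx (f 1) p + c) (k : ℕ) (p : ℝ × ℝ) :
    pdt (f (k + 1)) p = 2 * u p * pdx (f (k + 1)) p + if k = 0 then c else 0 := by
  induction k generalizing p with
  | zero => simpa using ht p
  | succ k ih =>
    have hk := contDiff_tower hz hzx h1 hrec k
    have hk' := contDiff_tower hz hzx h1 hrec (k + 1)
    have pdx_const : ∀ a : ℝ, pdx (fun _ => a) p = 0 := fun a => by simp [pdx]
    have hf := hasDerivAt_characteristic (hk.pdx.differentiableAt_of_smooth p)
      (pdt_pdx_of_transport hu hk contDiff_const ih p)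
    have hzd := hasDerivAt_characteristic (hz.pdx.differentiableAt_of_smooth p)
      (pdt_pdx_of_transport hu hz contDiff_const (g := fun _ => 0) (by simpa using heqz) p)
    have hz0 := hzx p
    refine pdt_of_hasDerivAt_characteristic (hk'.differentiableAt_of_smooth p) ?_
    simp only [hrec (k + 1) (by omega)]
    refine ((hzd.inv (by simpa using hz0)).mul hf).congr_deriv ?_
    simp [pdx_const]
    field_simp
    ring

theorem hasDerivAt_comp_pi {m : ℕ} {P : (Fin m → ℝ) → ℝ} (hP : ContDiff ℝ (⊤ : ℕ∞) P)
    {F : Fin m → ℝ → ℝ} {F' : Fin m → ℝ} {s : ℝ} (hF : ∀ i, HasDerivAt (F i) (F' i) s) :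
    HasDerivAt (fun r => P (fun i => F i r)) (∑ i, pD P i (fun j => F j s) * F' i) s := by
  have hPd := hP.differentiableAt_of_smooth (fun j => F j s)
  have h := HasFDerivAt.comp_hasDerivAt s (l := P) hPd.hasFDerivAt (hasDerivAt_pi.2 hF)
  refine h.congr_deriv ?_
  have hpD : ∀ i, pD P i (fun j => F j s) = fderiv ℝ P (fun j => F j s) (Pi.single i 1) := by
    intro i
    refine HasDerivAt.deriv ?_
    refine HasFDerivAt.comp_hasDerivAt (F i s) (l := P) ?_
      (hasDerivAt_update (fun j => F j s) i (F i s))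
    simpa using hPd.hasFDerivAt
  simp only [hpD]
  refine (LinearMap.pi_apply_eq_sum_univ (fderiv ℝ P fun j => F j s).toLinearMap F').trans ?_
  refine Finset.sum_congr rfl fun i _ => ?_
  have he : (fun j => if i = j then (1 : ℝ) else 0) = Pi.single i 1 := by
    funext j
    simp [Pi.single_apply, eq_comm]
  simp [he, mul_comm]

theorem Fin.sum_univ_four_mul {M : Type*} [AddCommMonoid M] (m : ℕ) (f : Fin (4 * m) → M) :
    ∑ i, f i = ∑ k : Fin m, (f ⟨4 * k.val, by omega⟩ + f ⟨4 * k.val + 1, by omega⟩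
      + f ⟨4 * k.val + 2, by omega⟩ + f ⟨4 * k.val + 3, by omega⟩) := by
  induction m with
  | zero => rfl
  | succ m ih =>
    rw [Fin.sum_univ_castSucc (n := m)]
    refine Eq.trans ?_ (congrArg (· + _) (ih fun i => f (Fin.castLE (by omega) i)))
    change ∑ i : Fin (4 * m + 4), f i = _
    simp only [Fin.sum_univ_castSucc, add_assoc]
    rfl

/-- The sequence `α₁, β₁, γ₁, δ₁, α₂, β₂, γ₂, δ₂, …`. -/
noncomputable def interleave (α β γ δ : ℕ → ℝ × ℝ → ℝ) (i : ℕ) (q : ℝ × ℝ) : ℝ :=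
  if i % 4 = 0 then α (i / 4 + 1) q
  else if i % 4 = 1 then β (i / 4 + 1) q
  else if i % 4 = 2 then γ (i / 4 + 1) q
  else δ (i / 4 + 1) q

theorem interleave_eq (α β γ δ : ℕ → ℝ × ℝ → ℝ) (k : ℕ) :
    interleave α β γ δ (4 * k) = α (k + 1) ∧ interleave α β γ δ (4 * k + 1) = β (k + 1) ∧
    interleave α β γ δ (4 * k + 2) = γ (k + 1) ∧ interleave α β γ δ (4 * k + 3) = δ (k + 1) := by
  refine ⟨?_, ?_, ?_, ?_⟩ <;> funext q <;> simp [interleave, Nat.add_mod, Nat.mul_add_div]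

theorem forall_nat_of_four_mul {p : ℕ → Prop} (h0 : ∀ k, p (4 * k)) (h1 : ∀ k, p (4 * k + 1))
    (h2 : ∀ k, p (4 * k + 2)) (h3 : ∀ k, p (4 * k + 3)) (i : ℕ) : p i := by
  have hi := Nat.div_add_mod i 4
  have hlt := Nat.mod_lt i (by norm_num : 4 > 0)
  rw [← hi]
  interval_cases i % 4
  exacts [h0 _, h1 _, h2 _, h3 _]

/-- Conservation law for a sequence `A` all of whose members, except for the one of index `3`,
are constant along the characteristics. -/
theorem conservation_law_of_transport {u z : ℝ × ℝ → ℝ} (hu : ContDiff ℝ (⊤ : ℕ∞) u)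
    (hz : ContDiff ℝ (⊤ : ℕ∞) z) (heqz : ∀ p, pdt z p = 2 * u p * pdx z p)
    {A : ℕ → ℝ × ℝ → ℝ} (hA : ∀ i, ContDiff ℝ (⊤ : ℕ∞) (A i))
    (hAx : ∀ i p, pdx (A i) p = pdx z p * A (i + 4) p)
    (hAt : ∀ i p, pdt (A i) p = 2 * u p * pdx (A i) p + if i = 3 then -2 else 0)
    {N M : ℕ} (hN : 3 < N) {P : (Fin N → ℝ) → ℝ} (hP : ContDiff ℝ (⊤ : ℕ∞) P)
    {Q : (Fin M → ℝ) → ℝ} (hQ : ContDiff ℝ (⊤ : ℕ∞) Q) (p : ℝ × ℝ)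
    (hPQ : pD P ⟨3, hN⟩ (fun i => A i p)
      = -(1 / 2) * ∑ i : Fin M, pD Q i (fun j => A j p) * A (i + 4) p) :
    pdt (fun q => pdx z q * P (fun i => A i q)) p
      = pdx (fun q => 2 * u q * (pdx z q * P (fun i => A i q)) + Q (fun j => A j q)) p := by
  have slice_x : ∀ {k : ℝ × ℝ → ℝ}, ContDiff ℝ (⊤ : ℕ∞) k →
      HasDerivAt (fun x => k (x, p.2)) (pdx k p) p.1 := fun {k} hk =>
    ((hk.differentiableAt_of_smooth (p.1, p.2)).comp p.1
      (differentiableAt_id.prodMk (differentiableAt_const p.2))).hasDerivAt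
  have slice_t : ∀ {k : ℝ × ℝ → ℝ}, ContDiff ℝ (⊤ : ℕ∞) k →
      HasDerivAt (fun t => k (p.1, t)) (pdt k p) p.2 := fun {k} hk =>
    ((hk.differentiableAt_of_smooth (p.1, p.2)).comp p.2
      ((differentiableAt_const p.1).prodMk differentiableAt_id)).hasDerivAt
  have hPt := hasDerivAt_comp_pi hP fun i : Fin N => slice_t (hA i)
  have hPx := hasDerivAt_comp_pi hP fun i : Fin N => slice_x (hA i)
  have hQx := hasDerivAt_comp_pi hQ fun i : Fin M => slice_x (hA i)
  have hsum : ∑ i : Fin N, pD P i (fun j => A j p) * pdt (A i) p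
      = 2 * u p * ∑ i : Fin N, pD P i (fun j => A j p) * pdx (A i) p
        - 2 * pD P ⟨3, hN⟩ (fun j => A j p) := by
    have hsingle : ∑ i : Fin N, pD P i (fun j => A j p) * (if i.val = 3 then (-2 : ℝ) else 0)
        = pD P ⟨3, hN⟩ (fun j => A j p) * -2 := by
      rw [Finset.sum_eq_single ⟨3, hN⟩]
      · simp
      · intro i _ hi
        rw [if_neg fun h => hi (Fin.ext h), mul_zero]
      · simp
    simp_rw [hAt, mul_add]
    rw [Finset.sum_add_distrib, hsingle, Finset.mul_sum, sub_eq_add_neg]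
    congr 1
    · exact Finset.sum_congr rfl fun i _ => by ring
    · ring
  have hQsum : ∑ i : Fin M, pD Q i (fun j => A j p) * pdx (A i) p
      = pdx z p * ∑ i : Fin M, pD Q i (fun j => A j p) * A (i + 4) p := by
    rw [Finset.mul_sum]
    exact Finset.sum_congr rfl fun i _ => by rw [hAx]; ring
  have hzt : pdt (pdx z) p = 2 * u p * pdx (pdx z) p + 2 * pdx u p * pdx z p := by
    have h := pdt_pdx_of_transport hu hz contDiff_const (g := fun _ => 0) (by simpa using heqz) p
    simpa [pdx] using h
  have hl := ((slice_t hz.pdx).mul hPt).deriv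
  have hr := ((((slice_x hu).const_mul 2).mul ((slice_x hz.pdx).mul hPx)).add hQx).deriv
  refine hl.trans (Eq.trans ?_ hr.symm)
  simp only [Prod.mk.eta, Pi.mul_apply]
  rw [hsum, hQsum, hzt, hPQ]
  ring

theorem riemannN4_conservation_law_with_flux (u v w z : ℝ × ℝ → ℝ)
    (hu : ContDiff ℝ (⊤ : ℕ∞) u) (hv : ContDiff ℝ (⊤ : ℕ∞) v) (hw : ContDiff ℝ (⊤ : ℕ∞) w)
    (hz : ContDiff ℝ (⊤ : ℕ∞) z)
    (hequ : ∀ p : ℝ × ℝ, pdt u p = 2 * u p * pdx u p - 2 * v p)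
    (heqv : ∀ p : ℝ × ℝ, pdt v p = 2 * u p * pdx v p - 2 * w p)
    (heqw : ∀ p : ℝ × ℝ, pdt w p = 2 * u p * pdx w p - 2 * z p)
    (heqz : ∀ p : ℝ × ℝ, pdt z p = 2 * u p * pdx z p)
    (hzx : ∀ p : ℝ × ℝ, pdx z p ≠ 0)
    (n : ℕ) (hn : 2 ≤ n)
    (Q : (Fin (4 * (n - 1)) → ℝ) → ℝ) (hQ : ContDiff ℝ (⊤ : ℕ∞) Q)
    (P : (Fin (4 * n) → ℝ) → ℝ) (hP : ContDiff ℝ (⊤ : ℕ∞) P)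
    (hPQ : ∀ y : Fin (4 * n) → ℝ,
      pD P ⟨3, by omega⟩ y
        = -(1 / 2) * ∑ k : Fin (n - 1),
            (pD Q ⟨4 * k.val, by have := k.isLt; omega⟩ (fun j => y (Fin.castLE (by omega) j))
                * y ⟨4 * k.val + 4, by have := k.isLt; omega⟩
              + pD Q ⟨4 * k.val + 1, by have := k.isLt; omega⟩ (fun j => y (Fin.castLE (by omega) j))
                * y ⟨4 * k.val + 5, by have := k.isLt; omega⟩
              + pD Q ⟨4 * k.val + 2, by have := k.isLt; omega⟩ (fun j => y (Fin.castLE (by omega) j))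
                * y ⟨4 * k.val + 6, by have := k.isLt; omega⟩
              + pD Q ⟨4 * k.val + 3, by have := k.isLt; omega⟩ (fun j => y (Fin.castLE (by omega) j))
                * y ⟨4 * k.val + 7, by have := k.isLt; omega⟩))
    (α β γ δ : ℕ → ℝ × ℝ → ℝ)
    (hα1 : ∀ p : ℝ × ℝ,
      α 1 p = ((pdx w p) ^ 2 - 2 * pdx v p * pdx z p) * ((pdx z p) ^ 2)⁻¹)
    (hβ1 : ∀ p : ℝ × ℝ,
      β 1 p = ((pdx v p) ^ 2 - 2 * pdx u p * pdx w p + 2 * pdx z p) * ((pdx z p) ^ 2)⁻¹)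
    (hγ1 : ∀ p : ℝ × ℝ,
      γ 1 p = ((pdx w p) ^ 3 - 3 * pdx z p * pdx v p * pdx w p + 3 * (pdx z p) ^ 2 * pdx u p)
        * ((pdx z p) ^ 3)⁻¹)
    (hδ1 : ∀ p : ℝ × ℝ, δ 1 p = pdx w p * (pdx z p)⁻¹)
    (hαrec : ∀ k, 1 ≤ k → ∀ p : ℝ × ℝ, α (k + 1) p = (pdx z p)⁻¹ * pdx (α k) p)
    (hβrec : ∀ k, 1 ≤ k → ∀ p : ℝ × ℝ, β (k + 1) p = (pdx z p)⁻¹ * pdx (β k) p)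
    (hγrec : ∀ k, 1 ≤ k → ∀ p : ℝ × ℝ, γ (k + 1) p = (pdx z p)⁻¹ * pdx (γ k) p)
    (hδrec : ∀ k, 1 ≤ k → ∀ p : ℝ × ℝ, δ (k + 1) p = (pdx z p)⁻¹ * pdx (δ k) p) :
    ∀ p : ℝ × ℝ,
      pdt (fun q => pdx z q * P (fun i =>
        if i.val % 4 = 0 then α (i.val / 4 + 1) q
        else if i.val % 4 = 1 then β (i.val / 4 + 1) q
        else if i.val % 4 = 2 then γ (i.val / 4 + 1) q
        else δ (i.val / 4 + 1) q)) p
        = pdx (fun q => 2 * u q * (pdx z q * P (fun i =>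
        if i.val % 4 = 0 then α (i.val / 4 + 1) q
        else if i.val % 4 = 1 then β (i.val / 4 + 1) q
        else if i.val % 4 = 2 then γ (i.val / 4 + 1) q
        else δ (i.val / 4 + 1) q))
            + Q (fun j =>
        if j.val % 4 = 0 then α (j.val / 4 + 1) q
        else if j.val % 4 = 1 then β (j.val / 4 + 1) q
        else if j.val % 4 = 2 then γ (j.val / 4 + 1) q
        else δ (j.val / 4 + 1) q)) p := by
  intro p
  have pdx_const : ∀ (a : ℝ) q, pdx (fun _ => a) q = 0 := fun a q => by simp [pdx]
  have hzi := hz.pdx.inv hzx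
  have hαs : ContDiff ℝ (⊤ : ℕ∞) (α 1) := by
    rw [funext hα1]
    exact ((hw.pdx.pow 2).sub ((contDiff_const.mul hv.pdx).mul hz.pdx)).mul
      ((hz.pdx.pow 2).inv fun q => pow_ne_zero 2 (hzx q))
  have hβs : ContDiff ℝ (⊤ : ℕ∞) (β 1) := by
    rw [funext hβ1]
    exact (((hv.pdx.pow 2).sub ((contDiff_const.mul hu.pdx).mul hw.pdx)).add
      (contDiff_const.mul hz.pdx)).mul ((hz.pdx.pow 2).inv fun q => pow_ne_zero 2 (hzx q))
  have hγs : ContDiff ℝ (⊤ : ℕ∞) (γ 1) := by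
    rw [funext hγ1]
    exact (((hw.pdx.pow 3).sub (((contDiff_const.mul hz.pdx).mul hv.pdx).mul hw.pdx)).add
      ((contDiff_const.mul (hz.pdx.pow 2)).mul hu.pdx)).mul
      ((hz.pdx.pow 3).inv fun q => pow_ne_zero 3 (hzx q))
  have hδs : ContDiff ℝ (⊤ : ℕ∞) (δ 1) := by
    rw [funext hδ1]
    exact hw.pdx.mul hzi
  have transport_x : ∀ {f g : ℝ × ℝ → ℝ}, ContDiff ℝ (⊤ : ℕ∞) f → ContDiff ℝ (⊤ : ℕ∞) g →
      (∀ q, pdt f q = 2 * u q * pdx f q - 2 * g q) → ∀ q,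
      HasDerivAt (fun s : ℝ => pdx f (q.1 + s * (-2 * u q), q.2 + s * 1))
        (2 * pdx u q * pdx f q - 2 * pdx g q) 0 := by
    intro f g hf hg h q
    have hg' : pdx (fun r => -2 * g r) q = -2 * pdx g q := by simp [pdx]
    convert hasDerivAt_characteristic (hf.pdx.differentiableAt_of_smooth q)
      (pdt_pdx_of_transport hu hf (contDiff_const.mul hg) (g := fun r => -2 * g r)
        (fun r => by rw [h r]; ring) q) using 1
    rw [hg']
    ring
  have hdu := transport_x hu hv hequ
  have hdv := transport_x hv hw heqv
  have hdw := transport_x hw hz heqw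
  have hdz := transport_x hz contDiff_const (g := fun _ => 0) (by simpa using heqz)
  have hz0 : ∀ q : ℝ × ℝ, pdx z (q.1 + 0 * (-2 * u q), q.2 + 0 * 1) ≠ 0 := fun q => hzx _
  have hαt : ∀ q, pdt (α 1) q = 2 * u q * pdx (α 1) q + 0 := fun q => by
    refine pdt_of_hasDerivAt_characteristic (hαs.differentiableAt_of_smooth q) ?_
    simp only [hα1]
    refine ((((hdw q).pow 2).sub (((hdv q).const_mul 2).mul (hdz q))).mul
      (((hdz q).pow 2).inv (pow_ne_zero 2 (hz0 q)))).congr_deriv ?_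
    have := hzx q
    simp [pdx_const]
    field_simp
    ring
  have hβt : ∀ q, pdt (β 1) q = 2 * u q * pdx (β 1) q + 0 := fun q => by
    refine pdt_of_hasDerivAt_characteristic (hβs.differentiableAt_of_smooth q) ?_
    simp only [hβ1]
    refine (((((hdv q).pow 2).sub (((hdu q).const_mul 2).mul (hdw q))).add
      ((hdz q).const_mul 2)).mul (((hdz q).pow 2).inv (pow_ne_zero 2 (hz0 q)))).congr_deriv ?_
    have := hzx q
    simp [pdx_const]
    field_simp
    ring
  have hγt : ∀ q, pdt (γ 1) q = 2 * u q * pdx (γ 1) q + 0 := fun q => by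
    refine pdt_of_hasDerivAt_characteristic (hγs.differentiableAt_of_smooth q) ?_
    simp only [hγ1]
    refine (((((hdw q).pow 3).sub ((((hdz q).const_mul 3).mul (hdv q)).mul (hdw q))).add
      ((((hdz q).pow 2).const_mul 3).mul (hdu q))).mul
      (((hdz q).pow 3).inv (pow_ne_zero 3 (hz0 q)))).congr_deriv ?_
    have := hzx q
    simp [pdx_const]
    field_simp
    ring
  have hδt : ∀ q, pdt (δ 1) q = 2 * u q * pdx (δ 1) q + -2 := fun q => by
    refine pdt_of_hasDerivAt_characteristic (hδs.differentiableAt_of_smooth q) ?_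
    simp only [hδ1]
    refine ((hdw q).mul ((hdz q).inv (hz0 q))).congr_deriv ?_
    have := hzx q
    simp [pdx_const]
    field_simp
    ring
  have hI := interleave_eq α β γ δ
  have hI0 := fun k => (hI k).1
  have hI1 := fun k => (hI k).2.1
  have hI2 := fun k => (hI k).2.2.1
  have hI3 := fun k => (hI k).2.2.2
  have hrec_x : ∀ {f : ℕ → ℝ × ℝ → ℝ},
      (∀ k, 1 ≤ k → ∀ q, f (k + 1) q = (pdx z q)⁻¹ * pdx (f k) q) →
      ∀ k q, pdx (f (k + 1)) q = pdx z q * f (k + 1 + 1) q := fun h k q => by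
    rw [h (k + 1) (by omega), mul_inv_cancel_left₀ (hzx q)]
  refine conservation_law_of_transport (A := interleave α β γ δ) hu hz heqz ?_ ?_ ?_
    (by omega) hP hQ p ?_
  · refine forall_nat_of_four_mul ?_ ?_ ?_ ?_ <;> intro k
    · rw [hI0]; exact contDiff_tower hz hzx hαs hαrec k
    · rw [hI1]; exact contDiff_tower hz hzx hβs hβrec k
    · rw [hI2]; exact contDiff_tower hz hzx hγs hγrec k
    · rw [hI3]; exact contDiff_tower hz hzx hδs hδrec k
  · refine forall_nat_of_four_mul ?_ ?_ ?_ ?_ <;> intro k q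
    · rw [hI0, show 4 * k + 4 = 4 * (k + 1) by ring, hI0, hrec_x hαrec]
    · rw [hI1, show 4 * k + 1 + 4 = 4 * (k + 1) + 1 by ring, hI1, hrec_x hβrec]
    · rw [hI2, show 4 * k + 2 + 4 = 4 * (k + 1) + 2 by ring, hI2, hrec_x hγrec]
    · rw [hI3, show 4 * k + 3 + 4 = 4 * (k + 1) + 3 by ring, hI3, hrec_x hδrec]
  · refine forall_nat_of_four_mul ?_ ?_ ?_ ?_ <;> intro k q
    · rw [hI0, transport_tower hu hz heqz hzx hαs hαrec hαt k q, if_neg (by omega : ¬4 * k = 3)]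
      simp
    · rw [hI1, transport_tower hu hz heqz hzx hβs hβrec hβt k q,
        if_neg (by omega : ¬4 * k + 1 = 3)]
      simp
    · rw [hI2, transport_tower hu hz heqz hzx hγs hγrec hγt k q,
        if_neg (by omega : ¬4 * k + 2 = 3)]
      simp
    · rw [hI3, transport_tower hu hz heqz hzx hδs hδrec hδt k q]
      simp
  · rw [Fin.sum_univ_four_mul]
    exact hPQ fun i => interleave α β γ δ i p
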